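/- arXiv:math/0501303 — 12 statements merged into one kernel-verified Lean document; each statement's English description precedes it below -/
import Mathlib

section
/- For every n ≥ 2 and all P, Q ∈ Γ_n, the J-divergence decomposes as J(P‖Q) = 4·[I(P‖Q) + T(P‖Q)]. -/
open Real BigOperators

noncomputable def triangularD {n : ℕ} (p q : Fin n → ℝ) : ℝ :=
  ∑ i, (p i - q i) ^ 2 / (p i + q i)

noncomputable def hellingerD {n : ℕ} (p q : Fin n → ℝ) : ℝ :=
  (1 / 2) * ∑ i, (Real.sqrt (p i) - Real.sqrt (q i)) ^ 2

noncomputable def symChiSqD {n : ℕ} (p q : Fin n → ℝ) : ℝ :=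
  ∑ i, (p i - q i) ^ 2 * (p i + q i) / (p i * q i)

noncomputable def jDiv {n : ℕ} (p q : Fin n → ℝ) : ℝ :=
  ∑ i, (p i - q i) * Real.log (p i / q i)

noncomputable def jsDiv {n : ℕ} (p q : Fin n → ℝ) : ℝ :=
  (1 / 2) * ((∑ i, p i * Real.log (2 * p i / (p i + q i))) +
    (∑ i, q i * Real.log (2 * q i / (p i + q i))))

noncomputable def agDiv {n : ℕ} (p q : Fin n → ℝ) : ℝ :=
  ∑ i, ((p i + q i) / 2) * Real.log ((p i + q i) / (2 * Real.sqrt (p i * q i)))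

noncomputable def dStar {n : ℕ} (p q : Fin n → ℝ) : ℝ :=
  ∑ i, (p i - q i) ^ 4 / Real.sqrt ((p i * q i) ^ 3)

theorem stmt_0 (n : ℕ) (hn : 2 ≤ n) (p q : Fin n → ℝ)
    (hp : ∀ i, 0 < p i) (hq : ∀ i, 0 < q i)
    (hps : ∑ i, p i = 1) (hqs : ∑ i, q i = 1) :
    jDiv p q = 4 * (jsDiv p q + agDiv p q) := by
  unfold jDiv jsDiv agDiv
  rw [← Finset.sum_add_distrib, Finset.mul_sum, ← Finset.sum_add_distrib, Finset.mul_sum]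
  refine Finset.sum_congr rfl fun i _ => ?_
  have h1 := hp i
  have h2 := hq i
  have h3 : 0 < p i + q i := add_pos h1 h2
  have h4 : 0 < Real.sqrt (p i * q i) := Real.sqrt_pos.mpr (mul_pos h1 h2)
  rw [Real.log_div h1.ne' h2.ne', Real.log_div (by positivity) h3.ne',
    Real.log_div (by positivity) h3.ne', Real.log_div h3.ne' (by positivity),
    Real.log_mul two_ne_zero h1.ne', Real.log_mul two_ne_zero h2.ne',
    Real.log_mul two_ne_zero h4.ne', Real.log_sqrt (mul_pos h1 h2).le,
    Real.log_mul h1.ne' h2.ne']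
  ring
end

section
/- For every n ≥ 2 and all P, Q ∈ Γ_n, one has (1/4)·Δ(P‖Q) ≤ I(P‖Q). -/
open Real BigOperators

theorem aux_log {x : ℝ} (h0 : 0 ≤ x) (h1 : x < 1) :
    2 * x ≤ Real.log (1 + x) - Real.log (1 - x) := by
  have h := Real.hasSum_log_sub_log_of_abs_lt_one (x := x) (by rw [abs_lt]; constructor <;> linarith)
  have := le_hasSum h 0 (fun j _ => by positivity)
  simpa using this

theorem aux_pos {x : ℝ} (h0 : 0 ≤ x) (h1 : x < 1) :
    x ^ 2 ≤ (1 + x) * Real.log (1 + x) + (1 - x) * Real.log (1 - x) := by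
  have hd : ∀ y ∈ Set.Ico (0:ℝ) 1, HasDerivAt
      (fun y : ℝ => (1 + y) * Real.log (1 + y) + (1 - y) * Real.log (1 - y) - y ^ 2)
      (Real.log (1 + y) - Real.log (1 - y) - 2 * y) y := by
    intro y hy
    have ha : (1 + y) ≠ 0 := by linarith [hy.1]
    have hb : (1 - y) ≠ 0 := by linarith [hy.2]
    have e1 : HasDerivAt (fun y : ℝ => 1 + y) 1 y := (hasDerivAt_id y).const_add 1
    have e2 : HasDerivAt (fun y : ℝ => 1 - y) (-1) y := (hasDerivAt_id y).const_sub 1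
    have e := ((e1.mul (e1.log ha)).add (e2.mul (e2.log hb))).sub (hasDerivAt_pow 2 y)
    refine e.congr_deriv ?_
    field_simp
    norm_num
    try ring
  have hm : MonotoneOn
      (fun y : ℝ => (1 + y) * Real.log (1 + y) + (1 - y) * Real.log (1 - y) - y ^ 2)
      (Set.Ico 0 1) := by
    apply monotoneOn_of_deriv_nonneg (convex_Ico 0 1)
    · exact fun y hy => (hd y hy).continuousAt.continuousWithinAt
    · exact fun y hy => (hd y (interior_subset hy)).differentiableAt.differentiableWithinAt
    · intro y hy
      have hy := interior_subset hy
      rw [(hd y hy).deriv]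
      linarith [aux_log hy.1 hy.2]
  have := hm (by simp : (0:ℝ) ∈ Set.Ico (0:ℝ) 1) ⟨h0, h1⟩ h0
  norm_num at this
  linarith

theorem aux_term {a b : ℝ} (ha : 0 < a) (hb : 0 < b) (hab : b ≤ a) :
    (a - b) ^ 2 / (a + b) / 2 ≤
      a * Real.log (2 * a / (a + b)) + b * Real.log (2 * b / (a + b)) := by
  have hs : 0 < a + b := by linarith
  have h := aux_pos (x := (a - b) / (a + b)) (div_nonneg (by linarith) hs.le)
    (by rw [div_lt_one hs]; linarith)
  have e1 : 1 + (a - b) / (a + b) = 2 * a / (a + b) := by field_simp; ring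
  have e2 : 1 - (a - b) / (a + b) = 2 * b / (a + b) := by field_simp; ring
  rw [e1, e2] at h
  have h2 := mul_le_mul_of_nonneg_left h (by positivity : 0 ≤ (a + b) / 2)
  calc _ = (a + b) / 2 * ((a - b) / (a + b)) ^ 2 := by field_simp
    _ ≤ _ := h2
    _ = _ := by
      generalize Real.log (2 * a / (a + b)) = u
      generalize Real.log (2 * b / (a + b)) = v
      field_simp

theorem stmt_1 (n : ℕ) (hn : 2 ≤ n) (p q : Fin n → ℝ)
    (hp : ∀ i, 0 < p i) (hq : ∀ i, 0 < q i)
    (hps : ∑ i, p i = 1) (hqs : ∑ i, q i = 1) :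
    (1 / 4) * triangularD p q ≤ jsDiv p q := by
  unfold triangularD jsDiv
  rw [← Finset.sum_add_distrib, Finset.mul_sum, Finset.mul_sum]
  apply Finset.sum_le_sum
  intro i _
  rcases le_total (q i) (p i) with h | h
  · linarith [aux_term (hp i) (hq i) h]
  · have := aux_term (hq i) (hp i) h
    rw [add_comm (q i) (p i), show (q i - p i) ^ 2 = (p i - q i) ^ 2 by ring] at this
    linarith
end

section
/- For every n ≥ 2 and all P, Q ∈ Γ_n, one has I(P‖Q) ≤ h(P‖Q). -/
open Real BigOperators

lemma aux_g {x : ℝ} (hx : 1 ≤ x) : 0 ≤ 1 - 1 / x - 2 * Real.log x + Real.log ((x ^ 2 + 1) / 2) := by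
  have hd : ∀ y : ℝ, 1 ≤ y → HasDerivAt
      (fun x : ℝ => 1 - x⁻¹ - 2 * Real.log x + Real.log ((x ^ 2 + 1) / 2))
      ((y - 1) ^ 2 / (y ^ 2 * (y ^ 2 + 1))) y := by
    intro y hy
    have hy0 : y ≠ 0 := by positivity
    have h1 : HasDerivAt (fun x : ℝ => (x ^ 2 + 1) / 2) ((2 * y) / 2) y := by
      simpa using (((hasDerivAt_pow 2 y).add_const 1).div_const 2)
    have h := ((((hasDerivAt_inv hy0).const_sub 1).sub ((Real.hasDerivAt_log hy0).const_mul 2)).add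
      (h1.log (by positivity)))
    refine h.congr_deriv ?_
    have : y ^ 2 + 1 ≠ 0 := by positivity
    field_simp
    ring
  have hm : MonotoneOn (fun x : ℝ => 1 - x⁻¹ - 2 * Real.log x + Real.log ((x ^ 2 + 1) / 2))
      (Set.Ici 1) := by
    apply monotoneOn_of_deriv_nonneg (convex_Ici 1)
    · exact fun y hy => (hd y hy).continuousAt.continuousWithinAt
    · intro y hy
      rw [interior_Ici] at hy
      exact (hd y (le_of_lt hy)).differentiableAt.differentiableWithinAt
    · intro y hy
      rw [interior_Ici] at hy
      rw [(hd y (le_of_lt hy)).deriv]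
      positivity
  have := hm (Set.mem_Ici.2 le_rfl) (Set.mem_Ici.2 hx) hx
  norm_num at this
  rw [one_div]
  exact this

lemma aux_f {x : ℝ} (hx : 1 ≤ x) :
    2 * x ^ 2 * Real.log x - (x ^ 2 + 1) * Real.log ((x ^ 2 + 1) / 2) ≤ (x - 1) ^ 2 := by
  have hd : ∀ y : ℝ, 1 ≤ y → HasDerivAt
      (fun x : ℝ => (x - 1) ^ 2 - (2 * x ^ 2 * Real.log x
        - (x ^ 2 + 1) * Real.log ((x ^ 2 + 1) / 2)))
      (2 * y * (1 - 1 / y - 2 * Real.log y + Real.log ((y ^ 2 + 1) / 2))) y := by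
    intro y hy
    have hy0 : y ≠ 0 := by positivity
    have h0 : HasDerivAt (fun x : ℝ => x ^ 2) (2 * y) y := by
      simpa using hasDerivAt_pow 2 y
    have h1 : HasDerivAt (fun x : ℝ => (x ^ 2 + 1) / 2) ((2 * y) / 2) y :=
      (h0.add_const 1).div_const 2
    have h2 := ((hasDerivAt_id y).sub_const 1).pow 2
    have h := h2.sub (((h0.const_mul 2).mul (Real.hasDerivAt_log hy0)).sub
      ((h0.add_const 1).mul (h1.log (by positivity))))
    refine h.congr_deriv ?_
    have : y ^ 2 + 1 ≠ 0 := by positivity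
    simp
    field_simp
    ring
  have hm : MonotoneOn (fun x : ℝ => (x - 1) ^ 2 - (2 * x ^ 2 * Real.log x
        - (x ^ 2 + 1) * Real.log ((x ^ 2 + 1) / 2)))
      (Set.Ici 1) := by
    apply monotoneOn_of_deriv_nonneg (convex_Ici 1)
    · exact fun y hy => (hd y hy).continuousAt.continuousWithinAt
    · intro y hy
      rw [interior_Ici] at hy
      exact (hd y (le_of_lt hy)).differentiableAt.differentiableWithinAt
    · intro y hy
      rw [interior_Ici] at hy
      have hy1 : (1 : ℝ) ≤ y := le_of_lt hy
      rw [(hd y hy1).deriv]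
      exact mul_nonneg (by positivity) (aux_g hy1)
  have := hm (Set.mem_Ici.2 le_rfl) (Set.mem_Ici.2 hx) hx
  norm_num at this
  linarith

lemma aux_pt {a b : ℝ} (hb : 0 < b) (hab : b ≤ a) :
    a ^ 2 * Real.log (2 * a ^ 2 / (a ^ 2 + b ^ 2)) + b ^ 2 * Real.log (2 * b ^ 2 / (a ^ 2 + b ^ 2))
      ≤ (a - b) ^ 2 := by
  obtain ⟨x, hx, rfl⟩ : ∃ x : ℝ, 1 ≤ x ∧ a = x * b :=
    ⟨a / b, (one_le_div hb).2 hab, by field_simp⟩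
  have hx0 : x ≠ 0 := by positivity
  have e1 : 2 * (x * b) ^ 2 / ((x * b) ^ 2 + b ^ 2) = x ^ 2 / ((x ^ 2 + 1) / 2) := by
    field_simp
  have e2 : 2 * b ^ 2 / ((x * b) ^ 2 + b ^ 2) = ((x ^ 2 + 1) / 2)⁻¹ := by
    field_simp
  rw [e1, e2, Real.log_div (by positivity) (by positivity), Real.log_inv, Real.log_pow]
  have := mul_le_mul_of_nonneg_left (aux_f hx) (sq_nonneg b)
  push_cast
  nlinarith [this]

lemma aux_pq {p q : ℝ} (hp : 0 < p) (hq : 0 < q) :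
    p * Real.log (2 * p / (p + q)) + q * Real.log (2 * q / (p + q))
      ≤ (Real.sqrt p - Real.sqrt q) ^ 2 := by
  rcases le_total q p with h | h
  · have := aux_pt (Real.sqrt_pos.2 hq) (Real.sqrt_le_sqrt h)
    rwa [Real.sq_sqrt hp.le, Real.sq_sqrt hq.le] at this
  · have := aux_pt (Real.sqrt_pos.2 hp) (Real.sqrt_le_sqrt h)
    rw [Real.sq_sqrt hp.le, Real.sq_sqrt hq.le, add_comm q p] at this
    linarith [this, sub_sq_comm (Real.sqrt p) (Real.sqrt q)]

theorem stmt_2 (n : ℕ) (hn : 2 ≤ n) (p q : Fin n → ℝ)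
    (hp : ∀ i, 0 < p i) (hq : ∀ i, 0 < q i)
    (hps : ∑ i, p i = 1) (hqs : ∑ i, q i = 1) :
    jsDiv p q ≤ hellingerD p q := by
  unfold jsDiv hellingerD
  rw [← Finset.sum_add_distrib]
  exact mul_le_mul_of_nonneg_left (Finset.sum_le_sum fun i _ => aux_pq (hp i) (hq i)) (by norm_num)
end

section
/- For every n ≥ 2 and all P, Q ∈ Γ_n, one has h(P‖Q) ≤ (1/8)·J(P‖Q). -/
open Real BigOperators

theorem aux_ge (a b : ℝ) (hb : 0 < b) (hab : b ≤ a) :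
    4 * (a - b) ^ 2 ≤ (a ^ 2 - b ^ 2) * (2 * Real.log (a / b)) := by
  have h := Real.le_log_one_add_of_nonneg (x := (a - b) / b)
    (div_nonneg (by linarith) hb.le)
  have e1 : 1 + (a - b) / b = a / b := by field_simp; ring
  have e2 : 2 * ((a - b) / b) / ((a - b) / b + 2) = 2 * (a - b) / (a + b) := by
    have e3 : (a - b) / b + 2 = (a + b) / b := by field_simp; ring
    rw [e3]
    have : a + b ≠ 0 := by linarith
    field_simp
  rw [e1, e2, div_le_iff₀ (by linarith)] at h
  nlinarith [mul_le_mul_of_nonneg_left h (sub_nonneg.2 hab)]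

theorem aux (p q : ℝ) (hp : 0 < p) (hq : 0 < q) :
    4 * (Real.sqrt p - Real.sqrt q) ^ 2 ≤ (p - q) * Real.log (p / q) := by
  have ha := Real.sqrt_pos.2 hp
  have hb := Real.sqrt_pos.2 hq
  have ea := Real.sq_sqrt hp.le
  have eb := Real.sq_sqrt hq.le
  have el : ∀ x y : ℝ, Real.log (x ^ 2 / y ^ 2) = 2 * Real.log (x / y) := by
    intro x y
    rw [← div_pow, Real.log_pow]
    norm_num
  generalize Real.sqrt p = a at *
  generalize Real.sqrt q = b at *
  subst ea eb
  rw [el]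
  rcases le_total b a with h | h
  · exact aux_ge a b hb h
  · have h1 := aux_ge b a ha h
    have h2 : Real.log (b / a) = - Real.log (a / b) := by
      rw [← Real.log_inv, inv_div]
    rw [h2] at h1
    nlinarith

theorem stmt_3 (n : ℕ) (hn : 2 ≤ n) (p q : Fin n → ℝ)
    (hp : ∀ i, 0 < p i) (hq : ∀ i, 0 < q i)
    (hps : ∑ i, p i = 1) (hqs : ∑ i, q i = 1) :
    hellingerD p q ≤ (1 / 8) * jDiv p q := by
  have h : ∑ i, 4 * (Real.sqrt (p i) - Real.sqrt (q i)) ^ 2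
      ≤ ∑ i, (p i - q i) * Real.log (p i / q i) :=
    Finset.sum_le_sum fun i _ => aux (p i) (q i) (hp i) (hq i)
  rw [← Finset.mul_sum] at h
  unfold hellingerD jDiv
  linarith
end

section
/- For every n ≥ 2 and all P, Q ∈ Γ_n, one has (1/8)·J(P‖Q) ≤ T(P‖Q). -/
open Real BigOperators

lemma aux_nonneg (u : ℝ) (hu : 0 ≤ u) :
    u * Real.sinh u ≤ 2 * Real.cosh u * Real.log (Real.cosh u) := by
  have hd : ∀ x : ℝ, HasDerivAt
      (fun x => 2 * Real.log (Real.cosh x) - x * (Real.sinh x / Real.cosh x))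
      ((Real.sinh x * Real.cosh x - x) / Real.cosh x ^ 2) x := by
    intro x
    have hc := (Real.cosh_pos x).ne'
    have h1 := ((Real.hasDerivAt_cosh x).log hc).const_mul 2
    have h2 := (hasDerivAt_id x).mul ((Real.hasDerivAt_sinh x).div (Real.hasDerivAt_cosh x) hc)
    refine (h1.sub h2).congr_deriv ?_
    have h3 := Real.cosh_sq x
    simp only [id, Pi.div_apply]
    field_simp
    rw [h3]
    ring
  have hm : MonotoneOn
      (fun x => 2 * Real.log (Real.cosh x) - x * (Real.sinh x / Real.cosh x)) (Set.Ici 0) := by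
    apply monotoneOn_of_deriv_nonneg (convex_Ici 0)
    · exact fun x _ => (hd x).continuousAt.continuousWithinAt
    · exact fun x _ => (hd x).differentiableAt.differentiableWithinAt
    · intro x hx
      rw [interior_Ici] at hx
      have hx : 0 < x := hx
      rw [(hd x).deriv]
      have h1 := Real.self_le_sinh_iff.2 hx.le
      have h2 := Real.one_le_cosh x
      apply div_nonneg _ (by positivity)
      nlinarith
  have h := hm (Set.mem_Ici.2 le_rfl) (Set.mem_Ici.2 hu) hu
  have hc := Real.cosh_pos u
  simp at h
  have h4 : u * (Real.sinh u / Real.cosh u) * Real.cosh u = u * Real.sinh u := by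
    field_simp
  rw [← h4]
  nlinarith

lemma aux_all (u : ℝ) :
    u * Real.sinh u ≤ 2 * Real.cosh u * Real.log (Real.cosh u) := by
  rcases le_total 0 u with h | h
  · exact aux_nonneg u h
  · have := aux_nonneg (-u) (by linarith)
    simpa using this

lemma aux_ab (a b : ℝ) (ha : 0 < a) (hb : 0 < b) :
    (1 / 8) * ((a ^ 2 - b ^ 2) * Real.log (a ^ 2 / b ^ 2)) ≤
      ((a ^ 2 + b ^ 2) / 2) * Real.log ((a ^ 2 + b ^ 2) / (2 * Real.sqrt (a ^ 2 * b ^ 2))) := by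
  have h := aux_all (Real.log (a / b))
  have hab : 0 < a / b := by positivity
  rw [Real.cosh_log hab, Real.sinh_log hab] at h
  have e1 : (a / b + (a / b)⁻¹) / 2 = (a ^ 2 + b ^ 2) / (2 * (a * b)) := by field_simp
  have e2 : (a / b - (a / b)⁻¹) / 2 = (a ^ 2 - b ^ 2) / (2 * (a * b)) := by field_simp
  rw [e1, e2] at h
  rw [← mul_pow, Real.sqrt_sq (by positivity), ← div_pow, Real.log_pow]
  have h' := mul_le_mul_of_nonneg_left h (show 0 ≤ a * b / 2 by positivity)
  generalize Real.log ((a ^ 2 + b ^ 2) / (2 * (a * b))) = L at h' ⊢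
  generalize Real.log (a / b) = M at h' ⊢
  have e3 : a * b / 2 * (M * ((a ^ 2 - b ^ 2) / (2 * (a * b)))) = (a ^ 2 - b ^ 2) * M / 4 := by
    field_simp
    ring
  have e4 : a * b / 2 * (2 * ((a ^ 2 + b ^ 2) / (2 * (a * b))) * L) = (a ^ 2 + b ^ 2) / 2 * L := by
    field_simp
  rw [e3, e4] at h'
  push_cast
  linarith

theorem stmt_4 (n : ℕ) (hn : 2 ≤ n) (p q : Fin n → ℝ)
    (hp : ∀ i, 0 < p i) (hq : ∀ i, 0 < q i)
    (hps : ∑ i, p i = 1) (hqs : ∑ i, q i = 1) :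
    (1 / 8) * jDiv p q ≤ agDiv p q := by
  unfold jDiv agDiv
  rw [Finset.mul_sum]
  refine Finset.sum_le_sum fun i _ => ?_
  have h := aux_ab (Real.sqrt (p i)) (Real.sqrt (q i))
    (Real.sqrt_pos.2 (hp i)) (Real.sqrt_pos.2 (hq i))
  rwa [Real.sq_sqrt (hp i).le, Real.sq_sqrt (hq i).le] at h
end

section
/- For every n ≥ 2 and all P, Q ∈ Γ_n, one has T(P‖Q) ≤ (1/16)·Ψ(P‖Q). -/
open Real BigOperators

lemma ag_term_le (a b : ℝ) (ha : 0 < a) (hb : 0 < b) :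
    ((a + b) / 2) * Real.log ((a + b) / (2 * Real.sqrt (a * b))) ≤
      (1 / 16) * ((a - b) ^ 2 * (a + b) / (a * b)) := by
  have hab : 0 < a * b := mul_pos ha hb
  have hs : 0 < Real.sqrt (a * b) := Real.sqrt_pos.mpr hab
  have hu : 0 < (a + b) / (2 * Real.sqrt (a * b)) := by positivity
  have h1 := Real.log_le_sub_one_of_pos (pow_pos hu 2)
  rw [Real.log_pow, div_pow, mul_pow, Real.sq_sqrt hab.le] at h1
  push_cast at h1
  have h2 : (1 / 16) * ((a - b) ^ 2 * (a + b) / (a * b)) =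
      ((a + b) / 2) * (((a + b) ^ 2 / (2 ^ 2 * (a * b)) - 1) / 2) := by
    field_simp
    ring
  rw [h2]
  apply mul_le_mul_of_nonneg_left _ (by positivity)
  linarith

theorem stmt_5 (n : ℕ) (hn : 2 ≤ n) (p q : Fin n → ℝ)
    (hp : ∀ i, 0 < p i) (hq : ∀ i, 0 < q i)
    (hps : ∑ i, p i = 1) (hqs : ∑ i, q i = 1) :
    agDiv p q ≤ (1 / 16) * symChiSqD p q := by
  unfold agDiv symChiSqD
  rw [Finset.mul_sum]
  exact Finset.sum_le_sum fun i _ => ag_term_le (p i) (q i) (hp i) (hq i)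
end

section
/- For every n ≥ 2 and all P, Q ∈ Γ_n, one has I(P‖Q) − (1/4)·Δ(P‖Q) ≤ (2/3)·[h(P‖Q) − (1/4)·Δ(P‖Q)]. -/
open Real BigOperators

noncomputable def auxG (t : ℝ) : ℝ :=
  2 / 3 * (1 - t⁻¹) + 1 / 6 - 2 / 3 * ((t ^ 2 + 1) ^ 2)⁻¹ - (Real.log 2 + 2 * Real.log t - Real.log (t ^ 2 + 1))

noncomputable def auxF (t : ℝ) : ℝ :=
  (t - 1) ^ 2 / 3 + (t ^ 2 - 3 + 4 * (t ^ 2 + 1)⁻¹) / 12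
    - 1 / 2 * (t ^ 2 * (Real.log 2 + 2 * Real.log t - Real.log (t ^ 2 + 1))
      + (Real.log 2 - Real.log (t ^ 2 + 1)))

lemma auxL_deriv (t : ℝ) (ht : 0 < t) :
    HasDerivAt (fun t : ℝ => Real.log (t ^ 2 + 1)) (2 * t / (t ^ 2 + 1)) t := by
  have h1 : HasDerivAt (fun t : ℝ => t ^ 2 + 1) (2 * t) t := by
    simpa using (hasDerivAt_pow 2 t).add_const 1
  exact h1.log (by positivity)

lemma auxG_deriv (t : ℝ) (ht : 0 < t) :
    HasDerivAt auxG (2 * ((t ^ 2 + 1 - 2 * t) ^ 2 * (t ^ 2 + 1 + t)) / (3 * t ^ 2 * (t ^ 2 + 1) ^ 3)) t := by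
  have h1 : HasDerivAt (fun t : ℝ => t ^ 2 + 1) (2 * t) t := by
    simpa using (hasDerivAt_pow 2 t).add_const 1
  have h2 := (h1.pow 2).inv (by simp only [Pi.pow_apply]; positivity)
  have h3 := hasDerivAt_inv ht.ne'
  have h4 := Real.hasDerivAt_log ht.ne'
  have h5 := auxL_deriv t ht
  have := ((((h3.const_sub 1).const_mul (2 / 3)).add_const (1 / 6)).sub (h2.const_mul (2 / 3))).sub
    (((h4.const_mul 2).const_add (Real.log 2)).sub h5)
  refine this.congr_deriv ?_
  simp only [Pi.pow_apply]
  field_simp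
  ring

lemma auxF_deriv (t : ℝ) (ht : 0 < t) : HasDerivAt auxF (t * auxG t) t := by
  have h0 : HasDerivAt (fun t : ℝ => t ^ 2) (2 * t) t := by
    simpa using hasDerivAt_pow 2 t
  have h1 : HasDerivAt (fun t : ℝ => t ^ 2 + 1) (2 * t) t := h0.add_const 1
  have h2 := h1.inv (by positivity)
  have h4 := Real.hasDerivAt_log ht.ne'
  have h5 := auxL_deriv t ht
  have h6 := (((hasDerivAt_id t).sub_const 1).pow 2).div_const 3
  have := (h6.add (((h0.sub_const 3).add (h2.const_mul 4)).div_const 12)).sub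
    (((h0.mul (((h4.const_mul 2).const_add (Real.log 2)).sub h5)).add
      (h5.const_sub (Real.log 2))).const_mul (1 / 2))
  refine this.congr_deriv ?_
  simp only [auxG, id, Pi.sub_apply]
  field_simp
  ring

lemma auxG_mono : MonotoneOn auxG (Set.Ioi 0) := by
  apply monotoneOn_of_deriv_nonneg (convex_Ioi 0)
  · exact fun t ht => (auxG_deriv t ht).continuousAt.continuousWithinAt
  · rw [interior_Ioi]
    exact fun t ht => (auxG_deriv t ht).differentiableAt.differentiableWithinAt
  · rw [interior_Ioi]
    intro t ht
    have ht' : 0 < t := ht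
    rw [(auxG_deriv t ht).deriv]
    positivity

lemma auxG_one : auxG 1 = 0 := by
  norm_num [auxG]

lemma auxF_one : auxF 1 = 0 := by
  norm_num [auxF]

lemma auxF_nonneg (t : ℝ) (ht : 0 < t) : 0 ≤ auxF t := by
  rw [← auxF_one]
  rcases le_total t 1 with h | h
  · have : AntitoneOn auxF (Set.Ioc 0 1) := by
      apply antitoneOn_of_deriv_nonpos (convex_Ioc 0 1)
      · exact fun t ht => (auxF_deriv t ht.1).continuousAt.continuousWithinAt
      · rw [interior_Ioc]
        exact fun t ht => (auxF_deriv t ht.1).differentiableAt.differentiableWithinAt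
      · rw [interior_Ioc]
        intro t ht
        rw [(auxF_deriv t ht.1).deriv]
        have := auxG_mono (a := t) (b := 1) ht.1 (by simp) ht.2.le
        rw [auxG_one] at this
        exact mul_nonpos_of_nonneg_of_nonpos ht.1.le this
    exact this ⟨ht, h⟩ ⟨one_pos, le_rfl⟩ h
  · have : MonotoneOn auxF (Set.Ici 1) := by
      have hpos : ∀ s ∈ Set.Ici (1 : ℝ), 0 < s := fun s hs => lt_of_lt_of_le one_pos hs
      apply monotoneOn_of_deriv_nonneg (convex_Ici 1)
      · exact fun t ht => (auxF_deriv t (hpos t ht)).continuousAt.continuousWithinAt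
      · intro t ht
        exact (auxF_deriv t (hpos t (interior_subset ht))).differentiableAt.differentiableWithinAt
      · intro t ht
        have ht1 := interior_subset ht
        have ht0 := hpos t ht1
        rw [(auxF_deriv t ht0).deriv]
        have := auxG_mono (a := 1) (b := t) (by simp) ht0 ht1
        rw [auxG_one] at this
        exact mul_nonneg ht0.le this
    exact this (by simp) h h

lemma aux_point (a b : ℝ) (ha : 0 < a) (hb : 0 < b) :
    1 / 2 * (a ^ 2 * Real.log (2 * a ^ 2 / (a ^ 2 + b ^ 2)) + b ^ 2 * Real.log (2 * b ^ 2 / (a ^ 2 + b ^ 2)))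
      ≤ 1 / 3 * (a - b) ^ 2 + 1 / 12 * ((a ^ 2 - b ^ 2) ^ 2 / (a ^ 2 + b ^ 2)) := by
  have h := mul_nonneg (sq_nonneg b) (auxF_nonneg (a / b) (div_pos ha hb))
  have e : (a / b) ^ 2 + 1 = (a ^ 2 + b ^ 2) / b ^ 2 := by field_simp
  have hs : a ^ 2 + b ^ 2 ≠ 0 := by positivity
  have l1 : Real.log (2 * a ^ 2 / (a ^ 2 + b ^ 2)) = Real.log 2 + 2 * Real.log a - Real.log (a ^ 2 + b ^ 2) := by
    rw [Real.log_div (by positivity) hs, Real.log_mul (by norm_num) (by positivity), Real.log_pow]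
    norm_num
  have l2 : Real.log (2 * b ^ 2 / (a ^ 2 + b ^ 2)) = Real.log 2 + 2 * Real.log b - Real.log (a ^ 2 + b ^ 2) := by
    rw [Real.log_div (by positivity) hs, Real.log_mul (by norm_num) (by positivity), Real.log_pow]
    norm_num
  have l3 : Real.log ((a ^ 2 + b ^ 2) / b ^ 2) = Real.log (a ^ 2 + b ^ 2) - 2 * Real.log b := by
    rw [Real.log_div hs (by positivity), Real.log_pow]
    norm_num
  rw [auxF, e, Real.log_div ha.ne' hb.ne', l3] at h
  rw [l1, l2, ← sub_nonneg]
  refine h.trans_eq ?_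
  field_simp
  ring

theorem stmt_6 (n : ℕ) (hn : 2 ≤ n) (p q : Fin n → ℝ)
    (hp : ∀ i, 0 < p i) (hq : ∀ i, 0 < q i)
    (hps : ∑ i, p i = 1) (hqs : ∑ i, q i = 1) :
    jsDiv p q - (1 / 4) * triangularD p q ≤ (2 / 3) * (hellingerD p q - (1 / 4) * triangularD p q) := by
  have key : ∀ i, 1 / 2 * (p i * Real.log (2 * p i / (p i + q i)) + q i * Real.log (2 * q i / (p i + q i)))
      ≤ 1 / 3 * (Real.sqrt (p i) - Real.sqrt (q i)) ^ 2 + 1 / 12 * ((p i - q i) ^ 2 / (p i + q i)) := by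
    intro i
    have h := aux_point _ _ (Real.sqrt_pos.2 (hp i)) (Real.sqrt_pos.2 (hq i))
    rwa [Real.sq_sqrt (hp i).le, Real.sq_sqrt (hq i).le] at h
  have h := Finset.sum_le_sum (fun i (_ : i ∈ Finset.univ) => key i)
  rw [Finset.sum_add_distrib, ← Finset.mul_sum, ← Finset.mul_sum, ← Finset.mul_sum,
    Finset.sum_add_distrib] at h
  unfold jsDiv triangularD hellingerD
  linarith
end

section
/- For every n ≥ 2 and all P, Q ∈ Γ_n, one has h(P‖Q) − I(P‖Q) ≤ (1/2)·[T(P‖Q) − (1/8)·J(P‖Q)]. -/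
open Real BigOperators

lemma chi_hasDeriv (u : ℝ) : HasDerivAt
    (fun u : ℝ => Real.sinh u * Real.cosh u / 4 + 3 / 4 * u - Real.sinh u)
    ((Real.cosh u - 1) ^ 2 / 2) u := by
  have h := ((((Real.hasDerivAt_sinh u).mul (Real.hasDerivAt_cosh u)).div_const 4).add
    ((hasDerivAt_id u).const_mul (3 / 4))).sub (Real.hasDerivAt_sinh u)
  refine h.congr_deriv ?_
  nlinarith [Real.cosh_sq u]

lemma chi_nonneg {u : ℝ} (hu : 0 ≤ u) :
    0 ≤ Real.sinh u * Real.cosh u / 4 + 3 / 4 * u - Real.sinh u := by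
  have hm := monotone_of_hasDerivAt_nonneg chi_hasDeriv (fun u => by positivity)
  have := hm hu
  simpa using this

lemma psi_hasDeriv (u : ℝ) : HasDerivAt
    (fun u : ℝ => 3 / 4 * u * (Real.sinh u / Real.cosh u) - Real.log (Real.cosh u) / 2 - 1
      + (Real.cosh u)⁻¹)
    ((Real.sinh u * Real.cosh u / 4 + 3 / 4 * u - Real.sinh u) / Real.cosh u ^ 2) u := by
  have hc := (Real.cosh_pos u).ne'
  have h := (((((hasDerivAt_id u).const_mul (3 / 4)).mul
    ((Real.hasDerivAt_sinh u).div (Real.hasDerivAt_cosh u) hc)).sub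
    (((Real.hasDerivAt_cosh u).log hc).div_const 2)).sub_const 1).add
    ((Real.hasDerivAt_cosh u).inv hc)
  refine h.congr_deriv ?_
  have e := Real.cosh_sq u
  have e2 : Real.cosh u * Real.cosh u - Real.sinh u * Real.sinh u = 1 := by nlinarith
  rw [e2]
  simp only [id, Pi.div_apply]
  field_simp
  ring

lemma psi_nonneg {u : ℝ} (hu : 0 ≤ u) :
    0 ≤ 3 / 4 * u * (Real.sinh u / Real.cosh u) - Real.log (Real.cosh u) / 2 - 1
      + (Real.cosh u)⁻¹ := by
  have hm := monotoneOn_of_deriv_nonneg (convex_Ici (0 : ℝ))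
    (fun x _ => (psi_hasDeriv x).continuousAt.continuousWithinAt)
    (fun x _ => (psi_hasDeriv x).differentiableAt.differentiableWithinAt)
    (fun x hx => by
      rw [interior_Ici] at hx
      rw [(psi_hasDeriv x).deriv]
      exact div_nonneg (chi_nonneg (le_of_lt hx)) (by positivity))
  have := hm (Set.mem_Ici.2 le_rfl) (Set.mem_Ici.2 hu) hu
  simpa using this

lemma phi_nonneg (u : ℝ) :
    0 ≤ 3 / 4 * u * Real.sinh u - Real.cosh u * Real.log (Real.cosh u) / 2
      - Real.cosh u + 1 := by
  have key : ∀ u : ℝ, 0 ≤ u → 0 ≤ 3 / 4 * u * Real.sinh u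
      - Real.cosh u * Real.log (Real.cosh u) / 2 - Real.cosh u + 1 := by
    intro u hu
    have hc := Real.cosh_pos u
    have h := mul_nonneg hc.le (psi_nonneg hu)
    have e : Real.cosh u * (3 / 4 * u * (Real.sinh u / Real.cosh u)
        - Real.log (Real.cosh u) / 2 - 1 + (Real.cosh u)⁻¹)
        = 3 / 4 * u * Real.sinh u
          - Real.cosh u * Real.log (Real.cosh u) / 2 - Real.cosh u + 1 := by
      field_simp
    rwa [e] at h
  rcases le_total 0 u with h | h
  · exact key u h
  · have := key (-u) (by linarith)
    simpa using this

lemma term_ineq {p q : ℝ} (hp : 0 < p) (hq : 0 < q) :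
    (1 / 2) * (Real.sqrt p - Real.sqrt q) ^ 2
      - (1 / 2) * (p * Real.log (2 * p / (p + q)) + q * Real.log (2 * q / (p + q)))
    ≤ (1 / 2) * (((p + q) / 2) * Real.log ((p + q) / (2 * Real.sqrt (p * q)))
      - (1 / 8) * ((p - q) * Real.log (p / q))) := by
  have hr : 0 < Real.sqrt (p * q) := Real.sqrt_pos.2 (mul_pos hp hq)
  obtain ⟨u, hu⟩ : ∃ u, u = (Real.log p - Real.log q) / 2 := ⟨_, rfl⟩
  obtain ⟨r, hrd⟩ : ∃ r, r = Real.sqrt (p * q) := ⟨_, rfl⟩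
  have hlr : Real.log r = (Real.log p + Real.log q) / 2 := by
    rw [hrd, Real.log_sqrt (mul_pos hp hq).le, Real.log_mul hp.ne' hq.ne']
  have hsq : (Real.sqrt p - Real.sqrt q) ^ 2 = p + q - 2 * r := by
    rw [hrd, Real.sqrt_mul hp.le, sub_sq, Real.sq_sqrt hp.le, Real.sq_sqrt hq.le]; ring
  rw [← hrd] at hr
  have hpe : p = r * Real.exp u := by
    rw [← Real.exp_log hr, ← Real.exp_add, hlr, hu]
    conv_lhs => rw [← Real.exp_log hp]
    congr 1; ring
  have hqe : q = r * Real.exp (-u) := by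
    rw [← Real.exp_log hr, ← Real.exp_add, hlr, hu]
    conv_lhs => rw [← Real.exp_log hq]
    congr 1; ring
  have hc := Real.cosh_pos u
  have hadd : p + q = 2 * r * Real.cosh u := by
    rw [Real.cosh_eq, hpe, hqe]; ring
  have hsub : p - q = 2 * r * Real.sinh u := by
    rw [Real.sinh_eq, hpe, hqe]; ring
  have hlp : Real.log p = Real.log r + u := by linarith
  have hlq : Real.log q = Real.log r - u := by linarith
  have l1 : Real.log (2 * p / (p + q)) = u - Real.log (Real.cosh u) := by
    rw [hadd, Real.log_div (by positivity) (by positivity),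
      Real.log_mul (by norm_num) hp.ne', Real.log_mul (by positivity) hc.ne',
      Real.log_mul (by norm_num) hr.ne']; linarith
  have l2 : Real.log (2 * q / (p + q)) = -u - Real.log (Real.cosh u) := by
    rw [hadd, Real.log_div (by positivity) (by positivity),
      Real.log_mul (by norm_num) hq.ne', Real.log_mul (by positivity) hc.ne',
      Real.log_mul (by norm_num) hr.ne']; linarith
  have l3 : Real.log ((p + q) / (2 * r)) = Real.log (Real.cosh u) := by
    rw [hadd]; congr 1; field_simp
  have l4 : Real.log (p / q) = 2 * u := by
    rw [Real.log_div hp.ne' hq.ne']; linarith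
  rw [← hrd, l1, l2, l3, l4, hsq, hsub]
  have e : p * (u - Real.log (Real.cosh u)) + q * (-u - Real.log (Real.cosh u))
      = (p - q) * u - (p + q) * Real.log (Real.cosh u) := by ring
  rw [e, hsub, hadd]
  have := mul_nonneg hr.le (phi_nonneg u)
  nlinarith

theorem stmt_8 (n : ℕ) (hn : 2 ≤ n) (p q : Fin n → ℝ)
    (hp : ∀ i, 0 < p i) (hq : ∀ i, 0 < q i)
    (hps : ∑ i, p i = 1) (hqs : ∑ i, q i = 1) :
    hellingerD p q - jsDiv p q ≤ (1 / 2) * (agDiv p q - (1 / 8) * jDiv p q) := by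
  have h := Finset.sum_le_sum (fun i (_ : i ∈ Finset.univ) => term_ineq (hp i) (hq i))
  simp only [Finset.sum_sub_distrib, ← Finset.mul_sum, Finset.sum_add_distrib] at h
  exact h
end

section
/- For every n ≥ 2 and all P, Q ∈ Γ_n, one has (1/8)·J(P‖Q) − (1/4)·Δ(P‖Q) ≤ (2/3)·[T(P‖Q) − (1/4)·Δ(P‖Q)]. -/
open Real BigOperators

lemma aux_g_s10 (t : ℝ) (h0 : 0 ≤ t) (h1 : t < 1) :
    (log (1 + t) - log (1 - t)) / 4 - t / 3 - t / (6 * (1 - t ^ 2)) ≤ 0 := by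
  let g : ℝ → ℝ := fun t => (log (1 + t) - log (1 - t)) / 4 - t / 3 - t / (6 * (1 - t ^ 2))
  have hd : ∀ x ∈ Set.Ico (0:ℝ) 1, HasDerivAt g
      ((1 / (1 + x) - (-1) / (1 - x)) / 4 - 1 / 3
        - (1 * (6 * (1 - x ^ 2)) - x * (6 * (-(2 * x)))) / (6 * (1 - x ^ 2)) ^ 2) x := by
    intro x hx
    have a1 : 1 + x ≠ 0 := by linarith [hx.1]
    have a2 : 1 - x ≠ 0 := by linarith [hx.2]
    have a3 : 6 * (1 - x ^ 2) ≠ 0 := by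
      have : 6 * (1 - x ^ 2) = 6 * ((1 + x) * (1 - x)) := by ring
      rw [this]; positivity
    have d1 := ((hasDerivAt_id x).const_add 1).log a1
    have d2 := ((hasDerivAt_id x).const_sub 1).log a2
    have d4 : HasDerivAt (fun x : ℝ => 6 * (1 - x ^ 2)) (6 * (-(2 * x))) x := by
      have := (((hasDerivAt_pow 2 x).const_sub 1).const_mul 6)
      simpa using this
    exact (((d1.sub d2).div_const 4).sub ((hasDerivAt_id x).div_const 3)).sub
      ((hasDerivAt_id x).div d4 a3)
  have hanti : AntitoneOn g (Set.Ico 0 1) := by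
    apply antitoneOn_of_deriv_nonpos (convex_Ico 0 1)
    · intro x hx
      exact (hd x hx).continuousAt.continuousWithinAt
    · intro x hx
      exact (hd x (interior_subset hx)).differentiableAt.differentiableWithinAt
    · intro x hx
      have hx := interior_subset hx
      rw [(hd x hx).deriv]
      have a1 : 0 < 1 + x := by linarith [hx.1]
      have a2 : 0 < 1 - x := by linarith [hx.2]
      have a3 : 1 - x ^ 2 = (1 + x) * (1 - x) := by ring
      have : ((1 / (1 + x) - (-1) / (1 - x)) / 4 - 1 / 3
        - (1 * (6 * (1 - x ^ 2)) - x * (6 * (-(2 * x)))) / (6 * (1 - x ^ 2)) ^ 2)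
        = - (x ^ 4 / (3 * ((1 + x) * (1 - x)) ^ 2)) := by
        rw [a3]; field_simp; ring
      rw [this, neg_nonpos]
      positivity
  have := hanti (show (0:ℝ) ∈ Set.Ico (0:ℝ) 1 by simp) ⟨h0, h1⟩ h0
  simpa [g] using this

lemma aux_f_s10 (t : ℝ) (h0 : 0 ≤ t) (h1 : t < 1) :
    t * (log (1 + t) - log (1 - t)) / 4 - t ^ 2 / 6 + (log (1 + t) + log (1 - t)) / 3 ≤ 0 := by
  let f : ℝ → ℝ := fun t =>
    t * (log (1 + t) - log (1 - t)) / 4 - t ^ 2 / 6 + (log (1 + t) + log (1 - t)) / 3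
  have hd : ∀ x ∈ Set.Ico (0:ℝ) 1, HasDerivAt f
      ((1 * (log (1 + x) - log (1 - x)) + x * (1 / (1 + x) - (-1) / (1 - x))) / 4 - (2 * x) / 6
        + (1 / (1 + x) + (-1) / (1 - x)) / 3) x := by
    intro x hx
    have a1 : 1 + x ≠ 0 := by linarith [hx.1]
    have a2 : 1 - x ≠ 0 := by linarith [hx.2]
    have d1 := ((hasDerivAt_id x).const_add 1).log a1
    have d2 := ((hasDerivAt_id x).const_sub 1).log a2
    have d4 : HasDerivAt (fun x : ℝ => x ^ 2) (2 * x) x := by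
      simpa using hasDerivAt_pow 2 x
    exact ((((hasDerivAt_id x).mul (d1.sub d2)).div_const 4).sub (d4.div_const 6)).add
      ((d1.add d2).div_const 3)
  have hanti : AntitoneOn f (Set.Ico 0 1) := by
    apply antitoneOn_of_deriv_nonpos (convex_Ico 0 1)
    · intro x hx
      exact (hd x hx).continuousAt.continuousWithinAt
    · intro x hx
      exact (hd x (interior_subset hx)).differentiableAt.differentiableWithinAt
    · intro x hx
      have hx := interior_subset hx
      rw [(hd x hx).deriv]
      have a1 : 0 < 1 + x := by linarith [hx.1]
      have a2 : 0 < 1 - x := by linarith [hx.2]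
      have a3 : 1 - x ^ 2 = (1 + x) * (1 - x) := by ring
      have hg := aux_g_s10 x hx.1 hx.2
      rw [a3] at hg
      refine le_of_eq_of_le ?_ hg
      field_simp
      ring
  have := hanti (show (0:ℝ) ∈ Set.Ico (0:ℝ) 1 by simp) ⟨h0, h1⟩ h0
  simpa [f] using this

lemma aux_f' (t : ℝ) (h0 : -1 < t) (h1 : t < 1) :
    t * (log (1 + t) - log (1 - t)) / 4 - t ^ 2 / 6 + (log (1 + t) + log (1 - t)) / 3 ≤ 0 := by
  rcases le_total 0 t with h | h
  · exact aux_f_s10 t h h1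
  · have := aux_f_s10 (-t) (by linarith) (by linarith)
    rw [sub_neg_eq_add, ← sub_eq_add_neg] at this
    linarith

lemma aux_term_s10 (p q : ℝ) (hp : 0 < p) (hq : 0 < q) :
    (1 / 8) * ((p - q) * log (p / q)) - (1 / 4) * ((p - q) ^ 2 / (p + q)) ≤
      (2 / 3) * (((p + q) / 2) * log ((p + q) / (2 * √(p * q)))
        - (1 / 4) * ((p - q) ^ 2 / (p + q))) := by
  have hs : 0 < p + q := by positivity
  have e1 : 1 + (p - q) / (p + q) = 2 * p / (p + q) := by field_simp; ring
  have e2 : 1 - (p - q) / (p + q) = 2 * q / (p + q) := by field_simp; ring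
  have p1 : 0 < 2 * p / (p + q) := by positivity
  have p2 : 0 < 2 * q / (p + q) := by positivity
  have h := aux_f' ((p - q) / (p + q)) (by linarith) (by linarith)
  rw [e1, e2] at h
  rw [log_div (by positivity) hs.ne', log_div (by positivity) hs.ne',
    log_mul (by norm_num) hp.ne', log_mul (by norm_num) hq.ne'] at h
  rw [log_div hp.ne' hq.ne', log_div hs.ne' (by positivity), log_mul (by norm_num) (by positivity),
    log_sqrt (by positivity), log_mul hp.ne' hq.ne']
  have h2 := mul_nonpos_of_nonneg_of_nonpos hs.le h
  rw [← sub_nonpos]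
  have key : ∀ a b c d : ℝ, 1 / 8 * ((p - q) * (a - b)) - 1 / 4 * ((p - q) ^ 2 / (p + q)) -
      2 / 3 * ((p + q) / 2 * (c - (d + (a + b) / 2)) - 1 / 4 * ((p - q) ^ 2 / (p + q))) =
      (1 / 2) * ((p + q) * ((p - q) / (p + q) * (d + a - c - (d + b - c)) / 4
        - ((p - q) / (p + q)) ^ 2 / 6 + (d + a - c + (d + b - c)) / 3)) := by
    intro a b c d
    field_simp
    ring
  rw [key]
  linarith

theorem stmt_10 (n : ℕ) (hn : 2 ≤ n) (p q : Fin n → ℝ)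
    (hp : ∀ i, 0 < p i) (hq : ∀ i, 0 < q i)
    (hps : ∑ i, p i = 1) (hqs : ∑ i, q i = 1) :
    (1 / 8) * jDiv p q - (1 / 4) * triangularD p q ≤ (2 / 3) * (agDiv p q - (1 / 4) * triangularD p q) := by
  unfold jDiv triangularD agDiv
  simp only [Finset.mul_sum, ← Finset.sum_sub_distrib]
  exact Finset.sum_le_sum fun i _ => aux_term_s10 (p i) (q i) (hp i) (hq i)
end

section
/- For every n ≥ 2 and all P, Q ∈ Γ_n, one has T(P‖Q) − (1/8)·J(P‖Q) ≤ (2/3)·[T(P‖Q) − h(P‖Q)]. -/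
open Real BigOperators

lemma aux_G (t : ℝ) (ht : 0 ≤ t) : 0 ≤ sinh t * cosh t + 3 * t - 4 * sinh t := by
  have hd : ∀ x : ℝ, HasDerivAt (fun x : ℝ => sinh x * cosh x + 3 * x - 4 * sinh x)
      (cosh x * cosh x + sinh x * sinh x + 3 * 1 - 4 * cosh x) x := fun x =>
    (((hasDerivAt_sinh x).mul (hasDerivAt_cosh x)).add ((hasDerivAt_id' x).const_mul 3)).sub
      ((hasDerivAt_sinh x).const_mul 4)
  have hm := monotone_of_hasDerivAt_nonneg hd (fun x => by
    have := cosh_sq x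
    simp only [Pi.zero_apply]
    nlinarith [sq_nonneg (cosh x - 1)])
  simpa using hm ht

lemma aux_F (t : ℝ) (ht : 0 ≤ t) :
    0 ≤ 3 / 2 * (t * (sinh t / cosh t)) - log (cosh t) - 2 + 2 / cosh t := by
  have hd : ∀ x : ℝ, HasDerivAt
      (fun x : ℝ => 3 / 2 * (x * (sinh x / cosh x)) - log (cosh x) - 2 + 2 / cosh x)
      (3 / 2 * (1 * (sinh x / cosh x) + x * ((cosh x * cosh x - sinh x * sinh x) / cosh x ^ 2))
        - sinh x / cosh x + (0 * cosh x - 2 * sinh x) / cosh x ^ 2) x := fun x => by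
    have hc := (cosh_pos x).ne'
    exact (((((hasDerivAt_id' x).mul ((hasDerivAt_sinh x).div (hasDerivAt_cosh x) hc)).const_mul
      (3 / 2)).sub ((hasDerivAt_cosh x).log hc)).sub_const 2).add
      ((hasDerivAt_const x (2 : ℝ)).div (hasDerivAt_cosh x) hc)
  have hm : MonotoneOn
      (fun x : ℝ => 3 / 2 * (x * (sinh x / cosh x)) - log (cosh x) - 2 + 2 / cosh x)
      (Set.Ici 0) := by
    apply monotoneOn_of_deriv_nonneg (convex_Ici 0)
    · exact fun x _ => (hd x).continuousAt.continuousWithinAt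
    · exact fun x _ => (hd x).differentiableAt.differentiableWithinAt
    · intro x hx
      rw [interior_Ici] at hx
      rw [(hd x).deriv]
      have hg := aux_G x (le_of_lt hx)
      have hc := cosh_pos x
      have h1 : cosh x * cosh x - sinh x * sinh x = 1 := by
        have := cosh_sq x
        linarith
      rw [h1]
      have : 3 / 2 * (1 * (sinh x / cosh x) + x * (1 / cosh x ^ 2))
        - sinh x / cosh x + (0 * cosh x - 2 * sinh x) / cosh x ^ 2
        = (sinh x * cosh x + 3 * x - 4 * sinh x) / (2 * cosh x ^ 2) := by
        field_simp
        ring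
      rw [this]
      positivity
  have := hm (Set.mem_Ici.2 le_rfl) (Set.mem_Ici.2 ht) ht
  simpa using this

lemma aux_L0 (t : ℝ) (ht : 0 ≤ t) :
    cosh t * log (cosh t) + 2 * (cosh t - 1) ≤ 3 / 2 * (t * sinh t) := by
  have h := aux_F t ht
  have hc := cosh_pos t
  have h2 := mul_nonneg hc.le h
  have : cosh t * (3 / 2 * (t * (sinh t / cosh t)) - log (cosh t) - 2 + 2 / cosh t)
    = 3 / 2 * (t * sinh t) - cosh t * log (cosh t) - 2 * cosh t + 2 := by
    field_simp
  linarith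

lemma aux_L (t : ℝ) :
    cosh t * log (cosh t) + 2 * (cosh t - 1) ≤ 3 / 2 * (t * sinh t) := by
  rcases le_total 0 t with h | h
  · exact aux_L0 t h
  · have := aux_L0 (-t) (by linarith)
    simpa using this

lemma aux_pt_s12 (p q : ℝ) (hp : 0 < p) (hq : 0 < q) :
    ((p + q) / 2) * log ((p + q) / (2 * sqrt (p * q))) + (sqrt p - sqrt q) ^ 2
      ≤ 3 / 8 * ((p - q) * log (p / q)) := by
  obtain ⟨t, g, hg, rfl, rfl⟩ : ∃ t g : ℝ, 0 < g ∧ p = g * exp t ∧ q = g * exp (-t) := by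
    refine ⟨(log p - log q) / 2, exp ((log p + log q) / 2), exp_pos _, ?_, ?_⟩
    · rw [← exp_add]; ring_nf; rw [exp_log hp]
    · rw [← exp_add]; ring_nf; rw [exp_log hq]
  have e1 : exp t * exp (-t) = 1 := by rw [← exp_add]; simp
  have hpq : g * exp t * (g * exp (-t)) = g ^ 2 := by linear_combination g ^ 2 * e1
  have hs : sqrt (g * exp t) * sqrt (g * exp (-t)) = g := by
    rw [← sqrt_mul hp.le, hpq, sqrt_sq hg.le]
  have h3 : (sqrt (g * exp t) - sqrt (g * exp (-t))) ^ 2 = 2 * g * (cosh t - 1) := by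
    rw [sub_sq, sq_sqrt hp.le, sq_sqrt hq.le, mul_assoc, hs, cosh_eq]; ring
  have h4 : (g * exp t + g * exp (-t)) / (2 * sqrt (g * exp t * (g * exp (-t)))) = cosh t := by
    rw [hpq, sqrt_sq hg.le, cosh_eq]; field_simp
  have h5 : g * exp t / (g * exp (-t)) = exp (2 * t) := by
    rw [mul_div_mul_left _ _ hg.ne', ← exp_sub]; ring_nf
  rw [h3, h4, h5, log_exp]
  have h6 : (g * exp t + g * exp (-t)) / 2 = g * cosh t := by rw [cosh_eq]; ring
  have h7 : g * exp t - g * exp (-t) = 2 * g * sinh t := by rw [sinh_eq]; ring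
  rw [h6, h7]
  have := mul_le_mul_of_nonneg_left (aux_L t) hg.le
  linarith

theorem stmt_12 (n : ℕ) (hn : 2 ≤ n) (p q : Fin n → ℝ)
    (hp : ∀ i, 0 < p i) (hq : ∀ i, 0 < q i)
    (hps : ∑ i, p i = 1) (hqs : ∑ i, q i = 1) :
    agDiv p q - (1 / 8) * jDiv p q ≤ (2 / 3) * (agDiv p q - hellingerD p q) := by
  have h := Finset.sum_le_sum (s := Finset.univ)
    (fun i _ => aux_pt_s12 (p i) (q i) (hp i) (hq i))
  rw [Finset.sum_add_distrib, ← Finset.mul_sum] at h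
  unfold agDiv jDiv hellingerD
  linarith
end

section
/- For every n ≥ 2 and all P, Q ∈ Γ_n, one has (1/16)·Ψ(P‖Q) − (1/4)·Δ(P‖Q) ≤ (6/5)·[(1/16)·Ψ(P‖Q) − I(P‖Q)]. -/
open Real BigOperators

theorem js_aux (u : ℝ) (hu : |u| < 1) :
    (1 / 2) * ((1 + u) * Real.log (1 + u) + (1 - u) * Real.log (1 - u)) ≤
      u ^ 2 / (12 * (1 - u ^ 2)) + 5 * u ^ 2 / 12 := by
  have ht : u ^ 2 < 1 := by rwa [sq_lt_one_iff_abs_lt_one]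
  have ht0 : 0 ≤ u ^ 2 := sq_nonneg u
  have h1 := abs_lt.mp hu
  have hA := (Real.hasSum_log_sub_log_of_abs_lt_one hu).mul_left u
  have hB := Real.hasSum_pow_div_log_of_abs_lt_one (x := u ^ 2) (by rwa [abs_of_nonneg ht0])
  have hC := ((hA.sub hB).mul_left (1 / 2 : ℝ))
  have hD := ((hasSum_geometric_of_lt_one ht0 ht).mul_left (u ^ 2 / 12)).add
    (hasSum_ite_eq (0 : ℕ) (5 * u ^ 2 / 12))
  have hl : Real.log (1 - u ^ 2) = Real.log (1 + u) + Real.log (1 - u) := by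
    rw [← Real.log_mul (by linarith) (by linarith)]; congr 1; ring
  have hle := hasSum_le (fun k => ?_) hC hD
  · rw [hl] at hle
    have e : u ^ 2 / 12 * (1 - u ^ 2)⁻¹ = u ^ 2 / (12 * (1 - u ^ 2)) := by
      have : 1 - u ^ 2 ≠ 0 := by linarith
      field_simp
    rw [e] at hle
    linarith
  · have hk : (0 : ℝ) ≤ k := Nat.cast_nonneg k
    have e : 1 / 2 * (u * (2 * (1 / (2 * (k : ℝ) + 1)) * u ^ (2 * k + 1)) -
        (u ^ 2) ^ (k + 1) / ((k : ℝ) + 1)) =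
        (u ^ 2 * (u ^ 2) ^ k) * (1 / (2 * (2 * k + 1) * (k + 1))) := by
      rw [pow_succ, pow_mul, pow_succ]
      field_simp
      ring
    rw [e]
    rcases Nat.eq_zero_or_pos k with rfl | h
    · simp
      linarith
    · rw [if_neg (by omega)]
      have hk1 : (1 : ℝ) ≤ k := by exact_mod_cast h
      have : 1 / (2 * (2 * (k : ℝ) + 1) * (k + 1)) ≤ 1 / 12 := by
        apply one_div_le_one_div_of_le (by norm_num)
        nlinarith
      have := mul_le_mul_of_nonneg_left this (by positivity : 0 ≤ u ^ 2 * (u ^ 2) ^ k)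
      linarith

theorem js_term (p q : ℝ) (hp : 0 < p) (hq : 0 < q) :
    (6 / 5) * ((1 / 2) * (p * Real.log (2 * p / (p + q)) + q * Real.log (2 * q / (p + q)))) ≤
      (1 / 80) * ((p - q) ^ 2 * (p + q) / (p * q)) + (1 / 4) * ((p - q) ^ 2 / (p + q)) := by
  have hs : 0 < p + q := by linarith
  have h := js_aux ((p - q) / (p + q)) (by
    rw [abs_lt]
    constructor
    · rw [lt_div_iff₀ hs]; linarith
    · rw [div_lt_iff₀ hs]; linarith)
  have e1 : 1 + (p - q) / (p + q) = 2 * p / (p + q) := by field_simp; ring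
  have e2 : 1 - (p - q) / (p + q) = 2 * q / (p + q) := by field_simp; ring
  have e3 : 1 - ((p - q) / (p + q)) ^ 2 = 4 * p * q / (p + q) ^ 2 := by field_simp; ring
  rw [e1, e2, e3] at h
  have h' := mul_le_mul_of_nonneg_left h (by positivity : 0 ≤ 6 / 5 * ((p + q) / 2))
  generalize Real.log (2 * p / (p + q)) = a at *
  generalize Real.log (2 * q / (p + q)) = b at *
  have l : 6 / 5 * ((p + q) / 2) * (1 / 2 * (2 * p / (p + q) * a + 2 * q / (p + q) * b)) =
      (6 / 5) * ((1 / 2) * (p * a + q * b)) := by field_simp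
  have r : 6 / 5 * ((p + q) / 2) * (((p - q) / (p + q)) ^ 2 / (12 * (4 * p * q / (p + q) ^ 2)) +
      5 * ((p - q) / (p + q)) ^ 2 / 12) =
      (1 / 80) * ((p - q) ^ 2 * (p + q) / (p * q)) + (1 / 4) * ((p - q) ^ 2 / (p + q)) := by
    field_simp
    ring
  rw [l, r] at h'
  exact h'

theorem stmt_15 (n : ℕ) (hn : 2 ≤ n) (p q : Fin n → ℝ)
    (hp : ∀ i, 0 < p i) (hq : ∀ i, 0 < q i)
    (hps : ∑ i, p i = 1) (hqs : ∑ i, q i = 1) :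
    (1 / 16) * symChiSqD p q - (1 / 4) * triangularD p q ≤ (6 / 5) * ((1 / 16) * symChiSqD p q - jsDiv p q) := by
  have h := Finset.sum_le_sum (fun i (_ : i ∈ Finset.univ) => js_term (p i) (q i) (hp i) (hq i))
  rw [Finset.sum_add_distrib, ← Finset.mul_sum, ← Finset.mul_sum, ← Finset.mul_sum,
    ← Finset.mul_sum, Finset.sum_add_distrib] at h
  unfold symChiSqD triangularD jsDiv
  linarith
end

section
/- For every n ≥ 2 and all P, Q ∈ Γ_n, one has (1/16)·Ψ(P‖Q) − T(P‖Q) ≤ (1/64)·D*(P‖Q). -/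
open Real BigOperators

lemma key_log (x : ℝ) (hx : 1 ≤ x) :
    x * (x ^ 2 - 1) / 2 - x * Real.log x ≤ (x ^ 2 - 1) ^ 2 / 4 := by
  have h := Real.le_log_one_add_of_nonneg (x := x - 1) (by linarith)
  have e1 : 1 + (x - 1) = x := by ring
  have e2 : x - 1 + 2 = x + 1 := by ring
  rw [e1, e2] at h
  have h2 : x * (2 * (x - 1) / (x + 1)) ≤ x * Real.log x :=
    mul_le_mul_of_nonneg_left h (by linarith)
  have h3 : (x ^ 2 - 1) ^ 2 / 4 - x * (x ^ 2 - 1) / 2 + x * (2 * (x - 1) / (x + 1))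
      = (x - 1) ^ 3 * (x ^ 2 + 2 * x - 1) / (4 * (x + 1)) := by
    have : x + 1 ≠ 0 := by linarith
    field_simp
    ring
  have h4 : 0 ≤ (x - 1) ^ 3 * (x ^ 2 + 2 * x - 1) / (4 * (x + 1)) := by
    have a : 0 ≤ x - 1 := by linarith
    have b : 0 ≤ x ^ 2 + 2 * x - 1 := by nlinarith
    have c : 0 ≤ x + 1 := by linarith
    positivity
  linarith

lemma key_term (a b : ℝ) (ha : 0 < a) (hb : 0 < b) :
    (1 / 16) * ((a - b) ^ 2 * (a + b) / (a * b))
      - ((a + b) / 2) * Real.log ((a + b) / (2 * Real.sqrt (a * b)))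
      ≤ (1 / 64) * ((a - b) ^ 4 / Real.sqrt ((a * b) ^ 3)) := by
  have hab : 0 < a * b := mul_pos ha hb
  obtain ⟨g, hg⟩ : ∃ g, g = Real.sqrt (a * b) := ⟨_, rfl⟩
  have hg0 : 0 < g := hg ▸ Real.sqrt_pos.mpr hab
  have hgg : a * b = g ^ 2 := by rw [hg, Real.sq_sqrt hab.le]
  have h3 : Real.sqrt ((a * b) ^ 3) = g ^ 3 := by
    rw [hgg, show (g ^ 2) ^ 3 = (g ^ 3) ^ 2 by ring, Real.sqrt_sq (by positivity)]
  rw [h3, ← hg, hgg]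
  obtain ⟨x, hx⟩ : ∃ x, x = (a + b) / (2 * g) := ⟨_, rfl⟩
  have hs : a + b = 2 * g * x := by rw [hx]; field_simp
  have hx1 : 1 ≤ x := by
    rw [hx, le_div_iff₀ (by positivity), one_mul]
    refine (sq_le_sq₀ (by positivity) (by positivity)).mp ?_
    nlinarith [sq_nonneg (a - b)]
  have hd : (a - b) ^ 2 = 4 * g ^ 2 * (x ^ 2 - 1) := by
    have : (a - b) ^ 2 = (a + b) ^ 2 - 4 * (a * b) := by ring
    rw [this, hs, hgg]; ring
  have hd4 : (a - b) ^ 4 = (4 * g ^ 2 * (x ^ 2 - 1)) ^ 2 := by rw [← hd]; ring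
  rw [← hx, hd4, hd, hs]
  have k := mul_le_mul_of_nonneg_left (key_log x hx1) hg0.le
  have l1 : 1 / 16 * (4 * g ^ 2 * (x ^ 2 - 1) * (2 * g * x) / g ^ 2)
      = g * (x * (x ^ 2 - 1) / 2) := by
    field_simp
    ring
  have l2 : 1 / 64 * ((4 * g ^ 2 * (x ^ 2 - 1)) ^ 2 / g ^ 3)
      = g * ((x ^ 2 - 1) ^ 2 / 4) := by
    field_simp
    ring
  rw [l1, l2]
  linarith

theorem stmt_19 (n : ℕ) (hn : 2 ≤ n) (p q : Fin n → ℝ)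
    (hp : ∀ i, 0 < p i) (hq : ∀ i, 0 < q i)
    (hps : ∑ i, p i = 1) (hqs : ∑ i, q i = 1) :
    (1 / 16) * symChiSqD p q - agDiv p q ≤ (1 / 64) * dStar p q := by
  unfold symChiSqD agDiv dStar
  rw [Finset.mul_sum, Finset.mul_sum, ← Finset.sum_sub_distrib]
  exact Finset.sum_le_sum fun i _ => key_term (p i) (q i) (hp i) (hq i)
end
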